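/- Let C be a p-regular conjugacy class of G. Then dim_k kR_𝔭(G,C) = rank_{𝒪_𝔭} R_𝔭(G,C) = |S_{p'}(C)/∼|, the number of G-conjugacy classes contained in S_{p'}(C). Moreover kR_𝔭(G,C) is a local commutative k-algebra with residue field k; every composition factor of the kR(G)-module kR_𝔭(G,C) is isomorphic to D̄_C, occurring with multiplicity |S_{p'}(C)/∼|, and kR_𝔭(G,C)/Rad(kR_𝔭(G,C)) ≅ D̄_C. -/

import Mathlib

open scoped TensorProduct Classical

/-! Common definitions: the character ring of a finite group, following Bonnafé,
"On the character ring of a finite group". -/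

/-- The set of characters of finite-dimensional `K`-linear representations of `G`. -/
def charSet (K G : Type u) [Field K] [Group G] : Set (G → K) :=
  {f | ∃ V : FDRep K G, f = FDRep.character V}

/-- The character ring `R(G)` of virtual characters, i.e. the subring of the `K`-algebra of
functions `G → K` generated by the characters.  Over a splitting field of characteristic zero
this is exactly the set of `ℤ`-linear combinations of irreducible characters. -/
def charRing (K G : Type u) [Field K] [Group G] : Subring (G → K) :=
  Subring.closure (charSet K G)

/-- `g` is `p`-regular if its order is prime to `p`. -/
def IsPRegular (p : ℕ) {G : Type*} [Monoid G] (g : G) : Prop :=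
  Nat.Coprime (orderOf g) p

/-- `g` is a `p`-element if its order is a power of `p`. -/
def IsPElement (p : ℕ) {G : Type*} [Monoid G] (g : G) : Prop :=
  ∃ n : ℕ, orderOf g = p ^ n

/-- The `p'`-part `g_{p'}` of an element `g` of a finite group:  writing `orderOf g = q * m'`
with `q` the `p`-part of the order, this is `g ^ (q * u)` where `u` is the inverse of
`q` modulo `m'`; it is the unique `p`-regular power of `g` such that `g * g_{p'}⁻¹` is a
`p`-element commuting with it. -/
noncomputable def pPrimePart (p : ℕ) {G : Type*} [Group G] (g : G) : G :=
  g ^ (p ^ (orderOf g).factorization p *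
      (((p : ZMod (orderOf g / p ^ (orderOf g).factorization p)) ^
        (orderOf g).factorization p)⁻¹).val)

/-- The `p'`-section `S_{p'}(C)` of the conjugacy class `C` of `g` : the set of all
`x ∈ G` whose `p'`-part lies in the class of `g`. -/
def pSection (p : ℕ) {G : Type*} [Group G] (g : G) : Set G :=
  {x | IsConj g (pPrimePart p x)}

/-- The idempotent class function `e_C` attached to the class `C` of `g`:  the characteristic
function (with values in `K`) of the `p'`-section of `C`. -/
noncomputable def eFun (p : ℕ) (K : Type*) [Field K] {G : Type*} [Group G] (g : G) : G → K :=
  fun x => if IsConj g (pPrimePart p x) then 1 else 0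

/-- The number of conjugacy classes of `G` contained in a subset `S`. -/
noncomputable def numClassesIn {G : Type*} [Group G] (S : Set G) : ℕ :=
  Nat.card {c : ConjClasses G // c.carrier ⊆ S}

/-- The image of the localization `𝒪_𝔭` in the fraction field `K`: fractions `a / b` with
`b ∉ 𝔭`. -/
def locSet (𝒪 K : Type*) [CommRing 𝒪] [Field K] [Algebra 𝒪 K] (𝔭 : Ideal 𝒪) : Set K :=
  {x | ∃ a b : 𝒪, b ∉ 𝔭 ∧ x * algebraMap 𝒪 K b = algebraMap 𝒪 K a}

/-- `𝒪_𝔭 R(G)`: the `𝒪_𝔭`-span of the character ring inside class functions `G → K`,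
realized as the subring generated by `𝒪_𝔭`-constants and characters. -/
def locCharRing (𝒪 : Type*) (K : Type u) [CommRing 𝒪] [Field K] [Algebra 𝒪 K] (𝔭 : Ideal 𝒪)
    (G : Type u) [Group G] : Subring (G → K) :=
  Subring.closure ({f | ∃ x ∈ locSet 𝒪 K 𝔭, f = Function.const G x} ∪ charSet K G)

/-- The ideal `𝔭 · 𝒪_𝔭R(G)` of `𝒪_𝔭R(G)`, generated by the constants from `𝔭`. -/
def pConstIdeal (𝒪 : Type*) (K : Type u) [CommRing 𝒪] [Field K] [Algebra 𝒪 K] (𝔭 : Ideal 𝒪)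
    (G : Type u) [Group G] : Ideal (locCharRing 𝒪 K 𝔭 G) :=
  Ideal.span {f | ∃ a ∈ 𝔭, (f : G → K) = Function.const G (algebraMap 𝒪 K a)}

/-- `kR(G) = k ⊗_ℤ R(G)`, realized through the canonical identification
`k ⊗_ℤ R(G) ≅ 𝒪_𝔭R(G) ⧸ 𝔭·𝒪_𝔭R(G)` (where `k = 𝒪/𝔭`). -/
abbrev kCharRing (𝒪 : Type*) (K : Type u) [CommRing 𝒪] [Field K] [Algebra 𝒪 K] (𝔭 : Ideal 𝒪)
    (G : Type u) [Group G] :=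
  locCharRing 𝒪 K 𝔭 G ⧸ pConstIdeal 𝒪 K 𝔭 G

/-- The ideal of `𝒪_𝔭R(G)` cutting out the block `R_𝔭(G, C)` with identity element the
idempotent `e : 𝒪_𝔭R(G)`, reduced mod `𝔭`:  the block `kR(G)·ē` is canonically the quotient
by `𝔭·𝒪_𝔭R(G) + (1 - e)·𝒪_𝔭R(G)`. -/
def blockIdeal (𝒪 : Type*) (K : Type u) [CommRing 𝒪] [Field K] [Algebra 𝒪 K] (𝔭 : Ideal 𝒪)
    (G : Type u) [Group G] (e : locCharRing 𝒪 K 𝔭 G) : Ideal (locCharRing 𝒪 K 𝔭 G) :=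
  pConstIdeal 𝒪 K 𝔭 G ⊔ Ideal.span {1 - e}

/-- The block `kR_𝔭(G, C) = kR(G)·ē_C` of `kR(G)`, as a (unital) `k`-algebra, realized as the
quotient of `𝒪_𝔭R(G)` by `𝔭·𝒪_𝔭R(G) + (1 - e_C)·𝒪_𝔭R(G)`. -/
abbrev blockAlg (𝒪 : Type*) (K : Type u) [CommRing 𝒪] [Field K] [Algebra 𝒪 K] (𝔭 : Ideal 𝒪)
    (G : Type u) [Group G] (e : locCharRing 𝒪 K 𝔭 G) :=
  locCharRing 𝒪 K 𝔭 G ⧸ blockIdeal 𝒪 K 𝔭 G e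

/-- The constants, as a ring morphism `𝒪 →+* 𝒪_𝔭R(G)`. -/
noncomputable def constRingHom (𝒪 : Type*) (K : Type u) [CommRing 𝒪] [Field K] [Algebra 𝒪 K]
    (𝔭 : Ideal 𝒪) [𝔭.IsMaximal] (G : Type u) [Group G] : 𝒪 →+* locCharRing 𝒪 K 𝔭 G where
  toFun a := ⟨Function.const G (algebraMap 𝒪 K a),
    Subring.subset_closure (Or.inl ⟨algebraMap 𝒪 K a,
      ⟨a, 1, fun h => (Ideal.ne_top_iff_one 𝔭).mp (Ideal.IsMaximal.ne_top ‹_›) h, by simp⟩, rfl⟩)⟩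
  map_one' := Subtype.ext (funext fun g => by simp)
  map_mul' a b := Subtype.ext (funext fun g => by simp)
  map_zero' := Subtype.ext (funext fun g => by simp)
  map_add' a b := Subtype.ext (funext fun g => by simp)

/-- The structural morphism giving quotients of `𝒪_𝔭R(G)` by ideals containing
`𝔭·𝒪_𝔭R(G)` (such as `kR(G)` and its blocks) their `k = 𝒪/𝔭`-algebra structure. -/
noncomputable def kScalars (𝒪 : Type*) (K : Type u) [CommRing 𝒪] [Field K] [Algebra 𝒪 K]
    (𝔭 : Ideal 𝒪) [𝔭.IsMaximal] (G : Type u) [Group G]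
    (I : Ideal (locCharRing 𝒪 K 𝔭 G)) (hI : pConstIdeal 𝒪 K 𝔭 G ≤ I) :
    (𝒪 ⧸ 𝔭) →+* (locCharRing 𝒪 K 𝔭 G ⧸ I) :=
  Ideal.Quotient.lift 𝔭 ((Ideal.Quotient.mk I).comp (constRingHom 𝒪 K 𝔭 G))
    (fun a ha => by
      simp only [RingHom.comp_apply]
      exact Ideal.Quotient.eq_zero_iff_mem.mpr (hI (Ideal.subset_span ⟨a, ha, rfl⟩)))

/-- The `k`-algebra structure morphism of the block `kR_𝔭(G, C)`. -/
noncomputable def blockScalars (𝒪 : Type*) (K : Type u) [CommRing 𝒪] [Field K] [Algebra 𝒪 K]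
    (𝔭 : Ideal 𝒪) [𝔭.IsMaximal] (G : Type u) [Group G] (e : locCharRing 𝒪 K 𝔭 G) :
    (𝒪 ⧸ 𝔭) →+* blockAlg 𝒪 K 𝔭 G e :=
  kScalars 𝒪 K 𝔭 G (blockIdeal 𝒪 K 𝔭 G e) le_sup_left

/-- The Jacobson radical of a ring. -/
noncomputable def jacRad (A : Type*) [CommRing A] : Ideal A := (⊥ : Ideal A).jacobson

/-- The Loewy length of `A`: the least `n` with `(Rad A) ^ n = 0`. -/
noncomputable def loewyLength (A : Type*) [CommRing A] : ℕ :=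
  sInf {n : ℕ | jacRad A ^ n = ⊥}

/-- `Rad A / (Rad A)²`. -/
noncomputable abbrev radQuotient (A : Type*) [CommRing A] :=
  jacRad A ⧸ (Submodule.comap (jacRad A).subtype (jacRad A ^ 2 : Ideal A))

/-- `dim_k Rad(A)/Rad(A)²`, the `k`-vector space structure being induced by a ring morphism
`k →+* A`. -/
noncomputable def extDim (k : Type*) [CommRing k] {A : Type*} [CommRing A] (φ : k →+* A) : ℕ :=
  letI : Module k (radQuotient A) := Module.compHom _ φ
  Module.finrank k (radQuotient A)

/-- `dim_k A`, the `k`-vector space structure being induced by a ring morphism `k →+* A`. -/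
noncomputable def kDim (k : Type*) [CommRing k] {A : Type*} [CommRing A] (φ : k →+* A) : ℕ :=
  letI : Module k A := Module.compHom _ φ
  Module.finrank k A

/-- `dim_k I` for an ideal `I` of `A`, the `k`-vector space structure being induced by a ring
morphism `k →+* A`. -/
noncomputable def idealKDim (k : Type*) [CommRing k] {A : Type*} [CommRing A] (φ : k →+* A)
    (I : Ideal A) : ℕ :=
  letI : Module k I := Module.compHom _ φ
  Module.finrank k I

/-- The canonical embedding of the localization `𝒪_𝔭` into the fraction field `K`. -/
noncomputable def locToK (𝒪 K : Type*) [CommRing 𝒪] [IsDomain 𝒪] [Field K] [Algebra 𝒪 K]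
    [IsFractionRing 𝒪 K] (𝔭 : Ideal 𝒪) [𝔭.IsPrime] : Localization.AtPrime 𝔭 →+* K :=
  IsLocalization.lift (M := 𝔭.primeCompl) (g := algebraMap 𝒪 K)
    (fun y => isUnit_iff_ne_zero.mpr (fun h => y.2 (by
      have h0 : (y : 𝒪) = 0 := IsFractionRing.injective 𝒪 K (by simpa using h)
      rw [h0]; exact 𝔭.zero_mem)))

/-- Class functions `G → K` as a module over the localization `𝒪_𝔭`, through the canonical
embedding `𝒪_𝔭 → K`. -/
noncomputable def locModule (𝒪 : Type*) (K : Type u) [CommRing 𝒪] [IsDomain 𝒪] [Field K]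
    [Algebra 𝒪 K] [IsFractionRing 𝒪 K] (𝔭 : Ideal 𝒪) [𝔭.IsPrime] (G : Type u) :
    Module (Localization.AtPrime 𝔭) (G → K) :=
  Module.compHom _ (locToK 𝒪 K 𝔭)

/-- The rank over `𝒪_𝔭` of the block `R_𝔭(G, C) = 𝒪_𝔭R(G)·e_C`, where `C` is the class
of `g`. -/
noncomputable def blockLocRank (p : ℕ) (𝒪 : Type*) (K : Type u) [CommRing 𝒪] [IsDomain 𝒪]
    [Field K] [Algebra 𝒪 K] [IsFractionRing 𝒪 K] (𝔭 : Ideal 𝒪) [𝔭.IsPrime]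
    (G : Type u) [Group G] (g : G) : ℕ :=
  letI := locModule 𝒪 K 𝔭 G
  Module.finrank (Localization.AtPrime 𝔭)
    (Submodule.span (Localization.AtPrime 𝔭)
      {f : G → K | f ∈ locCharRing 𝒪 K 𝔭 G ∧ f * eFun p K g = f})

section Averages

/-- If `b ^ n = 1` with `n ≠ 0`, the average of the powers of `b` is idempotent. -/
theorem isIdempotentElem_average_pow {K A : Type*} [Field K] [CharZero K] [Ring A] [Algebra K A]
    {b : A} {n : ℕ} (hn : n ≠ 0) (hb : b ^ n = 1) :
    IsIdempotentElem ((n : K)⁻¹ • ∑ i ∈ Finset.range n, b ^ i) := by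
  have hmul : b * ∑ i ∈ Finset.range n, b ^ i = ∑ i ∈ Finset.range n, b ^ i := by
    have h := mul_geom_sum b n
    rw [hb, sub_self, sub_mul, one_mul, sub_eq_zero] at h
    exact h
  have hpow : ∀ j, b ^ j * ∑ i ∈ Finset.range n, b ^ i = ∑ i ∈ Finset.range n, b ^ i := by
    intro j
    induction j with
    | zero => simp
    | succ j ih => rw [pow_succ, mul_assoc, hmul, ih]
  have hsq : (∑ i ∈ Finset.range n, b ^ i) * ∑ i ∈ Finset.range n, b ^ i
      = (n : K) • ∑ i ∈ Finset.range n, b ^ i := by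
    conv_lhs => rw [Finset.sum_mul]
    rw [Finset.sum_congr rfl fun j _ => hpow j, Finset.sum_const, Finset.card_range,
      Nat.cast_smul_eq_nsmul]
  have hn' : (n : K) ≠ 0 := Nat.cast_ne_zero.mpr hn
  rw [IsIdempotentElem, smul_mul_smul_comm, hsq, smul_smul, mul_assoc, inv_mul_cancel₀ hn', mul_one]

/-- Orthogonality of the powers of a primitive root of unity. -/
theorem IsPrimitiveRoot.sum_pow_mul_inv_pow {K : Type*} [Field K] {z : K} {n : ℕ}
    (hz : IsPrimitiveRoot z n) {a i : ℕ} (ha : a < n) (hi : i < n) :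
    ∑ j ∈ Finset.range n, z ^ (j * a) * z⁻¹ ^ (j * i) = if a = i then (n : K) else 0 := by
  have hz0 : z ≠ 0 := hz.ne_zero (by omega)
  have hterm : ∀ j, z ^ (j * a) * z⁻¹ ^ (j * i) = (z ^ a * (z ^ i)⁻¹) ^ j := by
    intro j
    rw [mul_pow, ← pow_mul, inv_pow, inv_pow, ← pow_mul, mul_comm j a, mul_comm j i]
  simp_rw [hterm]
  split_ifs with h
  · subst h
    simp [mul_inv_cancel₀ (pow_ne_zero a hz0)]
  · have h1 : z ^ a * (z ^ i)⁻¹ - 1 ≠ 0 := by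
      intro h'
      apply h
      apply hz.pow_inj ha hi
      field_simp at h'
      simpa [sub_eq_zero] using h'
    have h2 : (z ^ a * (z ^ i)⁻¹) ^ n = 1 := by
      rw [mul_pow, inv_pow, ← pow_mul, ← pow_mul, mul_comm a, mul_comm i, pow_mul, pow_mul,
        hz.pow_eq_one]
      simp
    have h3 := geom_sum_mul (z ^ a * (z ^ i)⁻¹) n
    rw [h2, sub_self] at h3
    exact (mul_eq_zero.mp h3).resolve_right h1

end Averages

section Characters

/-- The traces of the powers of an operator of finite order dividing `n` are given by
power sums of `n`-th roots of unity. -/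
theorem exists_trace_pow_eq_sum {K V : Type*} [Field K] [CharZero K] [AddCommGroup V] [Module K V]
    [FiniteDimensional K V] {z : K} {n : ℕ} (hn : n ≠ 0) (hz : IsPrimitiveRoot z n)
    (A : Module.End K V) (hA : A ^ n = 1) :
    ∃ d : ℕ → ℕ, ∀ m : ℕ,
      LinearMap.trace K V (A ^ m) = ∑ j ∈ Finset.range n, (d j : K) * z ^ (j * m) := by
  have hn' : (n : K) ≠ 0 := Nat.cast_ne_zero.mpr hn
  have hzinv : ∀ j, (z⁻¹ ^ j) ^ n = 1 := fun j => by
    rw [← pow_mul, mul_comm, pow_mul, inv_pow, hz.pow_eq_one, inv_one, one_pow]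
  let P : ℕ → Module.End K V := fun j =>
    (n : K)⁻¹ • ∑ i ∈ Finset.range n, (z⁻¹ ^ j • A) ^ i
  have hP : ∀ j, IsIdempotentElem (P j) := fun j =>
    isIdempotentElem_average_pow hn (by rw [smul_pow, hzinv, hA, one_smul])
  have hlt : ∀ m < n, A ^ m = ∑ j ∈ Finset.range n, z ^ (j * m) • P j := by
    intro m hm
    simp only [P, smul_pow, Finset.smul_sum, smul_smul]
    rw [Finset.sum_comm]
    have : ∀ i ∈ Finset.range n,
        ∑ j ∈ Finset.range n, (z ^ (j * m) * ((n : K)⁻¹ * (z⁻¹ ^ j) ^ i)) • A ^ i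
          = if m = i then A ^ i else 0 := by
      intro i hi
      rw [← Finset.sum_smul]
      have h : ∑ j ∈ Finset.range n, z ^ (j * m) * ((n : K)⁻¹ * (z⁻¹ ^ j) ^ i)
          = (n : K)⁻¹ * ∑ j ∈ Finset.range n, z ^ (j * m) * z⁻¹ ^ (j * i) := by
        rw [Finset.mul_sum]
        exact Finset.sum_congr rfl fun j _ => by rw [← pow_mul]; ring
      rw [h, hz.sum_pow_mul_inv_pow hm (Finset.mem_range.mp hi)]
      split_ifs
      · rw [inv_mul_cancel₀ hn', one_smul]
      · rw [mul_zero, zero_smul]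
    rw [Finset.sum_congr rfl this, Finset.sum_ite_eq, if_pos (Finset.mem_range.mpr hm)]
  refine ⟨fun j => Module.finrank K (LinearMap.range (P j)), fun m => ?_⟩
  have hm : m % n < n := Nat.mod_lt _ (Nat.pos_of_ne_zero hn)
  have hAm : A ^ m = A ^ (m % n) := by
    conv_lhs => rw [← Nat.mod_add_div m n, pow_add, pow_mul, hA, one_pow, mul_one]
  rw [hAm, hlt _ hm, map_sum]
  refine Finset.sum_congr rfl fun j _ => ?_
  rw [map_smul, (LinearMap.IsIdempotentElem.isProj_range _ (hP j)).trace, smul_eq_mul, mul_comm]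
  congr 1
  conv_rhs => rw [← Nat.mod_add_div m n, mul_add, pow_add, mul_left_comm, pow_mul z n,
    hz.pow_eq_one, one_pow, mul_one]

/-- The trace of an operator of the form `f ↦ (x ↦ ∑ i, a i * f (σ i x))`. -/
theorem trace_sum_smul_funLeft {K X ι : Type*} [Field K] [Fintype X] [DecidableEq X]
    (s : Finset ι) (a : ι → K) (σ : ι → X → X) :
    LinearMap.trace K (X → K) (∑ i ∈ s, a i • LinearMap.funLeft K K (σ i))
      = ∑ i ∈ s, a i * ((Finset.univ.filter fun x => σ i x = x).card : K) := by
  rw [map_sum]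
  refine Finset.sum_congr rfl fun i _ => ?_
  rw [map_smul, smul_eq_mul, LinearMap.trace_eq_matrix_trace K (Pi.basisFun K X)]
  congr 1
  simp [Matrix.trace, LinearMap.funLeft_apply, Pi.single_apply]

/-- The character of the representation of `G` induced from the linear character of the cyclic
group generated by `c` sending `c` to the `n`-th root of unity `w⁻¹`. -/
theorem induced_cyclic_mem_charSet {K G : Type u} [Field K] [CharZero K] [Group G] [Fintype G]
    [DecidableEq G] (c : G) {n : ℕ} (hn : n ≠ 0) (hc : c ^ n = 1) (w : K) (hw : w ^ n = 1) :
    (fun g : G => (n : K)⁻¹ * ∑ i ∈ Finset.range n,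
      w ^ i * ((Finset.univ.filter fun x : G => c ^ i * x * g = x).card : K)) ∈ charSet K G := by
  let L : Module.End K (G → K) := LinearMap.funLeft K K (fun x => c * x)
  have hL : ∀ i, L ^ i = LinearMap.funLeft K K (fun x => c ^ i * x) := by
    intro i
    induction i with
    | zero => ext; simp [LinearMap.funLeft_apply]
    | succ i ih =>
      rw [pow_succ, ih]
      refine LinearMap.ext fun f => funext fun x => ?_
      simp [L, LinearMap.funLeft_apply, pow_succ', mul_assoc]
  let P : Module.End K (G → K) := (n : K)⁻¹ • ∑ i ∈ Finset.range n, (w • L) ^ i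
  have hP : IsIdempotentElem P := isIdempotentElem_average_pow hn (by
    rw [smul_pow, hw, hL, hc, one_smul]
    ext; simp [LinearMap.funLeft_apply])
  let ρ : Representation K G (G → K) :=
    { toFun := fun g => LinearMap.funLeft K K (fun x => x * g)
      map_one' := by ext; simp [LinearMap.funLeft_apply]
      map_mul' := fun a b => LinearMap.ext fun f => funext fun x => by
        simp [LinearMap.funLeft_apply, mul_assoc] }
  have hcomp : ∀ g, ρ g * P = ∑ i ∈ Finset.range n, ((n : K)⁻¹ * w ^ i) •
      LinearMap.funLeft K K (fun x => c ^ i * x * g) := by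
    intro g
    refine LinearMap.ext fun f => funext fun x => ?_
    simp [P, ρ, smul_pow, hL, LinearMap.funLeft_apply, Finset.mul_sum, mul_assoc]
  have hcomm : ∀ g, ρ g * P = P * ρ g := by
    intro g
    rw [hcomp]
    refine LinearMap.ext fun f => funext fun x => ?_
    simp [P, ρ, smul_pow, hL, LinearMap.funLeft_apply, Finset.mul_sum, mul_assoc]
  have hmem : ∀ g, ∀ f ∈ LinearMap.range P, ρ g f ∈ LinearMap.range P := by
    rintro g _ ⟨f, rfl⟩
    exact ⟨ρ g f, (LinearMap.congr_fun (hcomm g) f).symm⟩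
  let τ : Representation K G (LinearMap.range P) :=
    { toFun := fun g => (ρ g).restrict (hmem g)
      map_one' := by ext; simp
      map_mul' := fun a b => by ext; simp }
  refine ⟨FDRep.of τ, funext fun g => ?_⟩
  have hmemP : ∀ f, (ρ g * P) f ∈ LinearMap.range P := fun f => hmem g _ ⟨f, rfl⟩
  have hτ : τ g = (ρ g * P).restrict (fun f _ => hmemP f) := by
    refine LinearMap.ext fun f => Subtype.ext ?_
    have := (LinearMap.IsIdempotentElem.isProj_range _ hP).map_id f f.2
    change ρ g f = ρ g (P f)
    rw [this]
  change _ = LinearMap.trace K _ (τ g)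
  rw [hτ, LinearMap.trace_restrict_eq_of_forall_mem _ _ hmemP, hcomp, trace_sum_smul_funLeft,
    Finset.mul_sum]
  exact Finset.sum_congr rfl fun i _ => by ring

/-- The function counting the `x : G` with `x * g * x⁻¹ = c` is a linear combination of characters
with coefficients that are powers of a primitive root of unity. -/
theorem card_conj_eq_sum_charSet {K G : Type u} [Field K] [CharZero K] [Group G] [Fintype G]
    [DecidableEq G] (c : G) {z : K} {n : ℕ} (hn : n ≠ 0) (hz : IsPrimitiveRoot z n)
    (hc : c ^ n = 1) :
    ∃ (a : ℕ) (χ : ℕ → G → K), (∀ j, χ j ∈ charSet K G) ∧ ∀ g,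
      ((Finset.univ.filter fun x : G => x * g * x⁻¹ = c).card : K)
        = ∑ j ∈ Finset.range n, z ^ (j * a) * χ j g := by
  have hn' : (n : K) ≠ 0 := Nat.cast_ne_zero.mpr hn
  refine ⟨n - 1, fun j g => (n : K)⁻¹ * ∑ i ∈ Finset.range n,
      (z⁻¹ ^ j) ^ i * ((Finset.univ.filter fun x : G => c ^ i * x * g = x).card : K), fun j =>
      induced_cyclic_mem_charSet c hn hc (z⁻¹ ^ j) ?_, fun g => ?_⟩
  · rw [← pow_mul, mul_comm, pow_mul, inv_pow, hz.pow_eq_one, inv_one, one_pow]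
  · simp only [Finset.mul_sum]
    rw [Finset.sum_comm]
    have : ∀ i ∈ Finset.range n, ∑ j ∈ Finset.range n, z ^ (j * (n - 1)) * ((n : K)⁻¹ *
        ((z⁻¹ ^ j) ^ i * ((Finset.univ.filter fun x : G => c ^ i * x * g = x).card : K)))
        = if n - 1 = i then ((Finset.univ.filter fun x : G => c ^ i * x * g = x).card : K)
          else 0 := by
      intro i hi
      have h : ∑ j ∈ Finset.range n, z ^ (j * (n - 1)) * ((n : K)⁻¹ *
        ((z⁻¹ ^ j) ^ i * ((Finset.univ.filter fun x : G => c ^ i * x * g = x).card : K)))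
        = (n : K)⁻¹ * (∑ j ∈ Finset.range n, z ^ (j * (n - 1)) * z⁻¹ ^ (j * i)) *
          ((Finset.univ.filter fun x : G => c ^ i * x * g = x).card : K) := by
        rw [Finset.mul_sum, Finset.sum_mul]
        exact Finset.sum_congr rfl fun j _ => by rw [← pow_mul]; ring
      rw [h, hz.sum_pow_mul_inv_pow (by omega) (Finset.mem_range.mp hi)]
      split_ifs
      · rw [inv_mul_cancel₀ hn', one_mul]
      · simp
    rw [Finset.sum_congr rfl this, Finset.sum_ite_eq, if_pos (Finset.mem_range.mpr (by omega))]
    congr 2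
    ext x
    have hcinv : c ^ (n - 1) = c⁻¹ := by
      rw [eq_inv_iff_mul_eq_one, ← pow_succ, Nat.sub_add_cancel (by omega), hc]
    simp only [Finset.mem_filter, Finset.mem_univ, true_and, hcinv, mul_assoc]
    rw [inv_mul_eq_iff_eq_mul, ← mul_assoc, mul_inv_eq_iff_eq_mul]

end Characters
section LocalAlgebras

/-- A commutative ring with a morphism to a field with nil kernel which is onto is local. -/
theorem isLocalRing_of_nil_ker {B L : Type*} [CommRing B] [Field L] (ev : B →+* L)
    (hsurj : Function.Surjective ev) (hnil : ∀ b, ev b = 0 → IsNilpotent b) : IsLocalRing B := by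
  have : Nontrivial B := ev.domain_nontrivial
  have hloc : ∀ b, ev b ≠ 0 → IsUnit b := by
    intro b hb
    obtain ⟨c, hc⟩ := hsurj (ev b)⁻¹
    have h := hnil (b * c - 1) (by rw [map_sub, map_mul, hc, mul_inv_cancel₀ hb, map_one, sub_self])
    have h' := h.isUnit_add_one
    rw [sub_add_cancel] at h'
    exact isUnit_of_mul_isUnit_left h'
  refine IsLocalRing.of_isUnit_or_isUnit_one_sub_self fun b => ?_
  by_cases hb : ev b = 0
  · exact Or.inr (hloc _ (by rw [map_sub, hb, map_one, sub_zero]; exact one_ne_zero))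
  · exact Or.inl (hloc _ hb)

/-- If `ev : B → L` has nil kernel and `φ : k → B` is such that `ev ∘ φ` is onto, then `φ`
induces an isomorphism of the field `k` with `B / Rad B`. -/
theorem bijective_mk_jacRad_comp {k B L : Type*} [Field k] [CommRing B] [Field L] (φ : k →+* B)
    (ev : B →+* L) (hsurj : Function.Surjective (ev.comp φ))
    (hnil : ∀ b, ev b = 0 → IsNilpotent b) :
    Function.Bijective ((Ideal.Quotient.mk (jacRad B)).comp φ) := by
  have : Nontrivial B := ev.domain_nontrivial
  have hne : jacRad B ≠ ⊤ := by
    rw [jacRad, Ne, Ideal.jacobson_eq_top_iff]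
    exact bot_ne_top
  have : Nontrivial (B ⧸ jacRad B) := Ideal.Quotient.nontrivial_iff.mpr hne
  refine ⟨RingHom.injective _, fun q => ?_⟩
  obtain ⟨b, rfl⟩ := Ideal.Quotient.mk_surjective q
  obtain ⟨c, hc⟩ := hsurj (ev b)
  refine ⟨c, Ideal.Quotient.eq.mpr ?_⟩
  have hz : IsNilpotent (φ c - b) := hnil _ (by rw [map_sub, ← hc, RingHom.comp_apply, sub_self])
  exact Ideal.radical_le_jacobson (mem_nilradical.mpr hz)

/-- A finite-dimensional local `k`-algebra with residue field `k` has a composition series whose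
length is its dimension. -/
theorem exists_compositionSeries_length_eq_finrank {k B L : Type*} [Field k] [CommRing B] [Field L]
    [Algebra k B] [Module.Finite k B] (ev : B →+* L)
    (hsurj : Function.Surjective (ev.comp (algebraMap k B)))
    (hnil : ∀ b, ev b = 0 → IsNilpotent b) :
    ∃ s : CompositionSeries (Submodule B B),
      s.head = ⊥ ∧ s.last = ⊤ ∧ s.length = Module.finrank k B := by
  have : IsLocalRing B :=
    isLocalRing_of_nil_ker ev (fun l => (hsurj l).imp' (algebraMap k B) fun _ h => h) hnil
  have : IsNoetherian B B := isNoetherian_of_tower k inferInstance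
  have : IsArtinian B B := isArtinian_of_tower k inferInstance
  obtain ⟨s, h1, h2⟩ := isFiniteLength_iff_exists_compositionSeries.mp
    (isFiniteLength_iff_isNoetherian_isArtinian.mpr ⟨‹_›, ‹_›⟩ : IsFiniteLength B B)
  refine ⟨s, h1, h2, ?_⟩
  have hB := IsLocalRing.length_restrictScalars k B B
  have hres : Function.Surjective (algebraMap k (IsLocalRing.ResidueField B)) := by
    intro q
    obtain ⟨b, rfl⟩ := IsLocalRing.residue_surjective q
    obtain ⟨c, hc⟩ := hsurj (ev b)
    refine ⟨c, ?_⟩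
    rw [IsScalarTower.algebraMap_apply k B (IsLocalRing.ResidueField B),
      IsLocalRing.ResidueField.algebraMap_eq, ← sub_eq_zero, ← map_sub,
      IsLocalRing.residue_eq_zero_iff, IsLocalRing.mem_maximalIdeal, mem_nonunits_iff]
    have hz : IsNilpotent (algebraMap k B c - b) :=
      hnil _ (by rw [map_sub, ← hc, RingHom.comp_apply, sub_self])
    exact fun hu => hz.not_isUnit hu
  have h1' : Module.length (IsLocalRing.ResidueField k) (IsLocalRing.ResidueField B) = 1 := by
    rw [← Module.length_eq_of_surjective (S := k) (R := IsLocalRing.ResidueField k)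
        IsLocalRing.residue_surjective,
      Module.length_eq_of_surjective (S := k) (R := IsLocalRing.ResidueField B) hres]
    exact Module.length_eq_one _ _
  rw [h1', mul_one, Module.length_eq_finrank, ← Module.length_compositionSeries s h1 h2] at hB
  exact_mod_cast hB.symm

end LocalAlgebras

section PPrimePart

/-- The exponent defining the `p'`-part. -/
theorem exists_pPrimePart_eq_pow (p : ℕ) [Fact p.Prime] {G : Type*} [Group G] [Finite G] (x : G) :
    ∃ m s : ℕ, pPrimePart p x = x ^ m ∧ p ^ s * m ≡ p ^ s [MOD orderOf x] := by
  have hn : orderOf x ≠ 0 := (orderOf_pos x).ne'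
  refine ⟨_, (orderOf x).factorization p, rfl, ?_⟩
  set s := (orderOf x).factorization p
  set n' := orderOf x / p ^ s
  have hnn : p ^ s * n' = orderOf x := Nat.ordProj_mul_ordCompl_eq_self _ _
  have hn' : n' ≠ 0 := by rintro h; rw [h, mul_zero] at hnn; exact hn hnn.symm
  have : NeZero n' := ⟨hn'⟩
  have hcop : Nat.Coprime (p ^ s) n' :=
    (Nat.coprime_ordCompl Fact.out hn).pow_left s
  have h1 : p ^ s * ((((p : ZMod n') ^ s)⁻¹).val) ≡ 1 [MOD n'] := by
    rw [← ZMod.natCast_eq_natCast_iff]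
    push_cast
    rw [ZMod.natCast_zmod_val]
    exact_mod_cast ZMod.coe_mul_inv_eq_one (p ^ s) hcop
  have h2 := h1.mul_left' (p ^ s)
  rwa [hnn, mul_one] at h2

/-- A `p`-regular element is its own `p'`-part. -/
theorem pPrimePart_eq_self {p : ℕ} [Fact p.Prime] {G : Type*} [Group G] [Finite G] {g : G}
    (hg : IsPRegular p g) : pPrimePart p g = g := by
  obtain ⟨m, s, hm, h⟩ := exists_pPrimePart_eq_pow p g
  have h' : m ≡ 1 [MOD orderOf g] :=
    Nat.ModEq.cancel_left_of_coprime (c := p ^ s) (Nat.Coprime.pow_right s hg)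
      (by rwa [mul_one])
  rw [hm, pow_eq_pow_iff_modEq.mpr h', pow_one]

theorem pPrimePart_conj (p : ℕ) {G : Type*} [Group G] (h x : G) :
    pPrimePart p (h * x * h⁻¹) = h * pPrimePart p x * h⁻¹ := by
  have ho : orderOf (h * x * h⁻¹) = orderOf x :=
    orderOf_injective (MulAut.conj h).toMonoidHom (MulAut.conj h).injective x
  rw [pPrimePart, pPrimePart, ho, conj_pow]

theorem pSection_conj_iff (p : ℕ) {G : Type*} [Group G] (g h x : G) :
    h * x * h⁻¹ ∈ pSection p g ↔ x ∈ pSection p g := by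
  have hc : IsConj (pPrimePart p x) (pPrimePart p (h * x * h⁻¹)) := by
    rw [pPrimePart_conj]
    exact isConj_iff.mpr ⟨h, rfl⟩
  exact ⟨fun H => IsConj.trans H hc.symm, fun H => IsConj.trans H hc⟩

theorem eFun_eq_ite (p : ℕ) (K : Type*) [Field K] {G : Type*} [Group G] (g x : G) :
    eFun p K g x = if x ∈ pSection p g then 1 else 0 := rfl

theorem carrier_subset_pSection_iff (p : ℕ) {G : Type*} [Group G] (g x : G) :
    (ConjClasses.mk x).carrier ⊆ pSection p g ↔ x ∈ pSection p g := by
  refine ⟨fun h => h ConjClasses.mem_carrier_mk, fun h y hy => ?_⟩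
  rw [ConjClasses.mem_carrier_iff_mk_eq, eq_comm, ConjClasses.mk_eq_mk_iff_isConj,
    isConj_iff] at hy
  obtain ⟨c, rfl⟩ := hy
  exact (pSection_conj_iff p g c x).mpr h

end PPrimePart
section CharacterValues

/-- `f : G → K` takes values in the local ring `R`, is a class function, and is congruent to its
value at the `p'`-part modulo the maximal ideal of `R`. -/
def IsLocalClassFun (p : ℕ) (R : Type*) {K G : Type*} [CommRing R] [IsLocalRing R] [Field K]
    [Algebra R K] [Group G] (f : G → K) : Prop :=
  ∃ F : G → R, (∀ x, algebraMap R K (F x) = f x) ∧ (∀ h x, F (h * x * h⁻¹) = F x) ∧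
    ∀ x, IsLocalRing.residue R (F x) = IsLocalRing.residue R (F (pPrimePart p x))

/-- If `w ^ n = 1` and `p ^ s * m ≡ p ^ s` modulo `n`, then `w ^ m = w` in characteristic `p`. -/
theorem pow_eq_self_of_pow_eq_one_of_modEq {L : Type*} [Field L] (p : ℕ) [Fact p.Prime] [CharP L p]
    {w : L} {n m s : ℕ} (hw : w ^ n = 1) (h : p ^ s * m ≡ p ^ s [MOD n]) : w ^ m = w := by
  have h1 : w ^ (p ^ s * m) = w ^ p ^ s := by
    rw [pow_eq_pow_mod _ hw, h, ← pow_eq_pow_mod _ hw]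
  have h2 : (w ^ m - w) ^ p ^ s = 0 := by
    rw [sub_pow_char_pow, ← pow_mul, mul_comm m, h1, sub_self]
  exact sub_eq_zero.mp ((pow_eq_zero_iff (pow_ne_zero s (Fact.out : p.Prime).ne_zero)).mp h2)

/-- An integrally closed subring contains the roots of unity. -/
theorem exists_algebraMap_eq_of_pow_eq_one {R K : Type*} [CommRing R] [IsIntegrallyClosed R]
    [Field K] [Algebra R K] [IsFractionRing R K] {z : K} {n : ℕ} (hn : n ≠ 0) (hz : z ^ n = 1) :
    ∃ w : R, algebraMap R K w = z :=
  IsIntegrallyClosed.isIntegral_iff.mp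
    (IsIntegral.of_pow (Nat.pos_of_ne_zero hn) (by rw [hz]; exact isIntegral_one))

theorem isLocalClassFun_of_mem_charSet (p : ℕ) [Fact p.Prime] (R : Type*) {K G : Type u}
    [CommRing R] [IsDomain R] [IsIntegrallyClosed R] [IsLocalRing R] [Field K] [CharZero K]
    [Algebra R K] [IsFractionRing R K] [CharP (IsLocalRing.ResidueField R) p]
    [Group G] [Finite G] {z : K} (hz : IsPrimitiveRoot z (Nat.card G)) {f : G → K}
    (hf : f ∈ charSet K G) : IsLocalClassFun p R f := by
  obtain ⟨V, rfl⟩ := hf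
  have hinj : Function.Injective (algebraMap R K) := IsFractionRing.injective R K
  have hpow : ∀ x : G, ∃ (d : ℕ → ℕ) (w : R), w ^ orderOf x = 1 ∧ ∀ m,
      V.character (x ^ m) = algebraMap R K (∑ j ∈ Finset.range (orderOf x),
        (d j : R) * w ^ (j * m)) := by
    intro x
    have hn : orderOf x ≠ 0 := (orderOf_pos x).ne'
    obtain ⟨t, ht⟩ := orderOf_dvd_natCard x
    have hz' : IsPrimitiveRoot (z ^ t) (orderOf x) :=
      hz.pow Nat.card_pos (by rw [ht, mul_comm])
    obtain ⟨w, hw⟩ := exists_algebraMap_eq_of_pow_eq_one (R := R) hn hz'.pow_eq_one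
    obtain ⟨d, hd⟩ := exists_trace_pow_eq_sum hn hz' (V.ρ x)
      (by rw [← map_pow, pow_orderOf_eq_one, map_one])
    refine ⟨d, w, hinj (by rw [map_pow, hw, hz'.pow_eq_one, map_one]), fun m => ?_⟩
    have : V.character (x ^ m) = LinearMap.trace K V (V.ρ x ^ m) := by
      rw [← map_pow]; rfl
    rw [this, hd]
    simp [hw]
  have hval : ∀ x, ∃ r : R, algebraMap R K r = V.character x := by
    intro x
    obtain ⟨d, w, -, h⟩ := hpow x
    exact ⟨_, by rw [← h 1, pow_one]⟩
  choose F hF using hval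
  refine ⟨F, hF, fun h x => hinj ?_, fun x => ?_⟩
  · rw [hF, hF, FDRep.char_conj]
  · obtain ⟨d, w, hw, h⟩ := hpow x
    obtain ⟨m, s, hm, hs⟩ := exists_pPrimePart_eq_pow p x
    have h1 := hinj ((hF (x ^ 1)).trans (h 1))
    have h2 := hinj ((hF (x ^ m)).trans (h m))
    rw [pow_one] at h1
    rw [hm, h1, h2, map_sum, map_sum]
    refine Finset.sum_congr rfl fun j _ => ?_
    have hw' : IsLocalRing.residue R w ^ orderOf x = 1 := by rw [← map_pow, hw, map_one]
    rw [map_mul, map_mul, map_pow, map_pow, mul_one, mul_comm j m, pow_mul,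
      pow_eq_self_of_pow_eq_one_of_modEq p hw' hs]

variable {𝒪 : Type*} [CommRing 𝒪] {K : Type u} [Field K] [Algebra 𝒪 K] {𝔭 : Ideal 𝒪}
  {G : Type u} [Group G]

theorem charSet_subset_locCharRing : charSet K G ⊆ locCharRing 𝒪 K 𝔭 G :=
  fun _ hf => Subring.subset_closure (Or.inr hf)

variable (R : Type*) [CommRing R] [Algebra 𝒪 R] [Algebra R K] [IsScalarTower 𝒪 R K]

section

variable [𝔭.IsPrime] [IsLocalization.AtPrime R 𝔭]

theorem mem_locSet_iff [IsFractionRing 𝒪 K] [IsDomain 𝒪] {x : K} :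
    x ∈ locSet 𝒪 K 𝔭 ↔ ∃ r : R, algebraMap R K r = x := by
  constructor
  · rintro ⟨a, b, hb, h⟩
    refine ⟨IsLocalization.mk' R a (⟨b, hb⟩ : 𝔭.primeCompl), ?_⟩
    have hb0 : algebraMap 𝒪 K b ≠ 0 := by
      intro h0
      apply hb
      rw [(IsFractionRing.injective 𝒪 K) (h0.trans (map_zero _).symm)]
      exact 𝔭.zero_mem
    apply mul_right_cancel₀ hb0
    have hs := IsLocalization.mk'_spec R a (⟨b, hb⟩ : 𝔭.primeCompl)
    rw [h, IsScalarTower.algebraMap_apply 𝒪 R K b, ← map_mul, hs,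
      ← IsScalarTower.algebraMap_apply]
  · rintro ⟨r, rfl⟩
    obtain ⟨a, s, rfl⟩ := IsLocalization.exists_mk'_eq 𝔭.primeCompl r
    refine ⟨a, s, s.2, ?_⟩
    rw [IsScalarTower.algebraMap_apply 𝒪 R K s, ← map_mul, IsLocalization.mk'_spec,
      ← IsScalarTower.algebraMap_apply]

theorem const_mem_locCharRing [IsFractionRing 𝒪 K] [IsDomain 𝒪] (r : R) :
    Function.const G (algebraMap R K r) ∈ locCharRing 𝒪 K 𝔭 G :=
  Subring.subset_closure (Or.inl ⟨_, (mem_locSet_iff R).mpr ⟨r, rfl⟩, rfl⟩)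

theorem smul_mem_locCharRing [IsFractionRing 𝒪 K] [IsDomain 𝒪] (r : R) {f : G → K}
    (hf : f ∈ locCharRing 𝒪 K 𝔭 G) : r • f ∈ locCharRing 𝒪 K 𝔭 G := by
  have : r • f = Function.const G (algebraMap R K r) * f :=
    funext fun x => Algebra.smul_def r (f x)
  rw [this]
  exact mul_mem (const_mem_locCharRing R r) hf

theorem isLocalClassFun_of_mem_locCharRing (p : ℕ) [Fact p.Prime] [IsFractionRing 𝒪 K] [IsDomain 𝒪]
    [IsDomain R] [IsIntegrallyClosed R] [IsLocalRing R] [CharZero K] [IsFractionRing R K]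
    [CharP (IsLocalRing.ResidueField R) p] [Finite G] {z : K}
    (hz : IsPrimitiveRoot z (Nat.card G)) {f : G → K} (hf : f ∈ locCharRing 𝒪 K 𝔭 G) :
    IsLocalClassFun p R f := by
  induction hf using Subring.closure_induction with
  | mem f hf =>
    rcases hf with ⟨x, hx, rfl⟩ | hf
    · obtain ⟨r, rfl⟩ := (mem_locSet_iff R).mp hx
      exact ⟨fun _ => r, fun _ => rfl, fun _ _ => rfl, fun _ => rfl⟩
    · exact isLocalClassFun_of_mem_charSet p R hz hf
  | zero => exact ⟨0, by simp, by simp, by simp⟩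
  | one => exact ⟨1, by simp, by simp, by simp⟩
  | add f g _ _ hf hg =>
    obtain ⟨A, a1, a2, a3⟩ := hf
    obtain ⟨B, b1, b2, b3⟩ := hg
    exact ⟨A + B, by simp [a1, b1], by simp [a2, b2], fun x => by
      rw [Pi.add_apply, Pi.add_apply, map_add, map_add, a3, b3]⟩
  | mul f g _ _ hf hg =>
    obtain ⟨A, a1, a2, a3⟩ := hf
    obtain ⟨B, b1, b2, b3⟩ := hg
    exact ⟨A * B, by simp [a1, b1], by simp [a2, b2], fun x => by
      rw [Pi.mul_apply, Pi.mul_apply, map_mul, map_mul, a3, b3]⟩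
  | neg f _ hf =>
    obtain ⟨A, a1, a2, a3⟩ := hf
    exact ⟨-A, by simp [a1], by simp [a2], fun x => by
      rw [Pi.neg_apply, Pi.neg_apply, map_neg, map_neg, a3]⟩

/-- `|G|` times any `R`-valued class function is an `R`-combination of characters. -/
theorem card_smul_mem_locCharRing [IsFractionRing 𝒪 K] [IsDomain 𝒪] [IsDomain R]
    [IsIntegrallyClosed R] [CharZero K] [IsFractionRing R K] [Finite G] {z : K}
    (hz : IsPrimitiveRoot z (Nat.card G)) (F : G → R) (hF : ∀ h x, F (h * x * h⁻¹) = F x) :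
    (fun x => algebraMap R K ((Nat.card G : R) * F x)) ∈ locCharRing 𝒪 K 𝔭 G := by
  have := Fintype.ofFinite G
  have hcount : ∀ c : G, (fun g => ((Finset.univ.filter fun x : G => x * g * x⁻¹ = c).card : K))
      ∈ locCharRing 𝒪 K 𝔭 G := by
    intro c
    obtain ⟨a, χ, hχ, h⟩ := card_conj_eq_sum_charSet c Nat.card_pos.ne' hz pow_card_eq_one'
    have hw : z ^ Nat.card G = 1 := hz.pow_eq_one
    obtain ⟨w, rfl⟩ := exists_algebraMap_eq_of_pow_eq_one (R := R) Nat.card_pos.ne' hw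
    have : (fun g => ((Finset.univ.filter fun x : G => x * g * x⁻¹ = c).card : K))
        = ∑ j ∈ Finset.range (Nat.card G), (w ^ (j * a)) • χ j := by
      funext g
      rw [h, Finset.sum_apply]
      exact Finset.sum_congr rfl fun j _ => by
        rw [Pi.smul_apply, Algebra.smul_def, map_pow]
    rw [this]
    exact sum_mem fun j _ => smul_mem_locCharRing R _ (charSet_subset_locCharRing (hχ j))
  have : (fun x => algebraMap R K ((Nat.card G : R) * F x)) = ∑ c : G, F c • fun g =>
      ((Finset.univ.filter fun x : G => x * g * x⁻¹ = c).card : K) := by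
    funext g
    have h1 : (Nat.card G : R) * F g = ∑ x : G, F (x * g * x⁻¹) := by
      simp [hF, Nat.card_eq_fintype_card]
    rw [h1, Finset.sum_apply, map_sum, ← Finset.sum_fiberwise Finset.univ fun x => x * g * x⁻¹]
    refine Finset.sum_congr rfl fun c _ => ?_
    rw [Pi.smul_apply, Algebra.smul_def, Finset.sum_congr rfl (g := fun _ => algebraMap R K (F c)),
      Finset.sum_const, nsmul_eq_mul, mul_comm]
    intro x hx
    rw [(Finset.mem_filter.mp hx).2]
  rw [this]
  exact sum_mem fun c _ => smul_mem_locCharRing R _ (hcount c)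

end

end CharacterValues
section Block

/-- A submodule squeezed between a free module of finite rank and a nonzero multiple of it is free
of the same rank. -/
theorem finrank_eq_card_of_le_range {R E σ : Type*} [CommRing R] [IsDomain R]
    [IsNoetherianRing R] [AddCommGroup E] [Module R E] [Fintype σ] (Ω : (σ → R) →ₗ[R] E)
    (hΩ : Function.Injective Ω) (N : Submodule R E) (hN : N ≤ LinearMap.range Ω) {a : R}
    (ha : a ≠ 0) (haN : ∀ v, Ω (a • v) ∈ N) :
    Module.Finite R N ∧ Module.finrank R N = Fintype.card σ := by
  let e : (σ → R) ≃ₗ[R] LinearMap.range Ω := LinearEquiv.ofInjective Ω hΩ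
  have : Module.Finite R (LinearMap.range Ω) := Module.Finite.equiv e
  have hfin : Module.Finite R N :=
    Module.Finite.of_injective (Submodule.inclusion hN) (Submodule.inclusion_injective hN)
  refine ⟨hfin, le_antisymm ?_ ?_⟩
  · calc Module.finrank R N ≤ Module.finrank R (LinearMap.range Ω) :=
          LinearMap.finrank_le_finrank_of_injective (Submodule.inclusion_injective hN)
      _ = Fintype.card σ := by rw [← e.finrank_eq, Module.finrank_fintype_fun_eq_card]
  · rw [← Module.finrank_fintype_fun_eq_card (R := R)]
    refine LinearMap.finrank_le_finrank_of_injective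
      (f := (Ω.comp (a • LinearMap.id)).codRestrict N haN) fun v w h => ?_
    have h' : a • v = a • w := hΩ (congrArg Subtype.val h)
    exact smul_right_injective _ ha h'

variable {𝒪 : Type*} [CommRing 𝒪] [IsDomain 𝒪] {K : Type u} [Field K] [Algebra 𝒪 K]
  [IsFractionRing 𝒪 K] {𝔭 : Ideal 𝒪} {G : Type u} [Group G]
  (R : Type*) [CommRing R] [Algebra 𝒪 R] [Algebra R K] [IsScalarTower 𝒪 R K]
  [𝔭.IsPrime] [IsLocalization.AtPrime R 𝔭]

variable (𝔭) in
/-- The block `R_𝔭(G, C)`, for `e` the idempotent attached to `C`, as a module over `R = 𝒪_𝔭`. -/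
def locBlock (e : G → K) : Submodule R (G → K) where
  carrier := {f | f ∈ locCharRing 𝒪 K 𝔭 G ∧ f * e = f}
  zero_mem' := ⟨zero_mem _, zero_mul _⟩
  add_mem' := fun ha hb => ⟨add_mem ha.1 hb.1, by rw [add_mul, ha.2, hb.2]⟩
  smul_mem' := fun r f hf => ⟨smul_mem_locCharRing R r hf.1, by rw [smul_mul_assoc, hf.2]⟩

theorem eFun_mul_self (p : ℕ) (g : G) : eFun p K g * eFun p K g = eFun p K g := by
  funext x
  simp [eFun]

theorem finite_and_finrank_locBlock (p : ℕ) [Fact p.Prime]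
    [IsDomain R] [IsIntegrallyClosed R] [IsLocalRing R] [IsNoetherianRing R] [CharZero K]
    [IsFractionRing R K] [CharP (IsLocalRing.ResidueField R) p] [Finite G] {z : K}
    (hz : IsPrimitiveRoot z (Nat.card G)) (g : G) :
    Module.Finite R (locBlock 𝔭 R (eFun p K g)) ∧
      Module.finrank R (locBlock 𝔭 R (eFun p K g)) = numClassesIn (pSection p g) := by
  have hinj : Function.Injective (algebraMap R K) := IsFractionRing.injective R K
  have : CharZero R := ⟨fun a b h => by
    have h' := congrArg (algebraMap R K) h
    rwa [map_natCast, map_natCast, Nat.cast_inj] at h'⟩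
  have := Fintype.ofFinite {c : ConjClasses G // c.carrier ⊆ pSection p g}
  let Ω : ({c : ConjClasses G // c.carrier ⊆ pSection p g} → R) →ₗ[R] (G → K) :=
    { toFun := fun v x => if h : (ConjClasses.mk x).carrier ⊆ pSection p g then
        algebraMap R K (v ⟨ConjClasses.mk x, h⟩) else 0
      map_add' := fun v w => by
        funext x
        simp only [Pi.add_apply]
        split_ifs <;> simp
      map_smul' := fun r v => by
        funext x
        simp only [Pi.smul_apply, RingHom.id_apply]
        split_ifs <;> simp [Algebra.smul_def] }
  have hΩ : ∀ v x, Ω v x = if h : (ConjClasses.mk x).carrier ⊆ pSection p g then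
        algebraMap R K (v ⟨ConjClasses.mk x, h⟩) else 0 := fun _ _ => rfl
  rw [numClassesIn, Nat.card_eq_fintype_card]
  refine finrank_eq_card_of_le_range Ω ?_ _ ?_ (a := (Nat.card G : R))
    (Nat.cast_ne_zero.mpr Nat.card_pos.ne') ?_
  · intro v w h
    funext ⟨c, hc⟩
    obtain ⟨x, rfl⟩ := ConjClasses.mk_surjective c
    have := congrFun h x
    rw [hΩ, hΩ, dif_pos hc, dif_pos hc] at this
    exact hinj this
  · rintro f ⟨hf, hfe⟩
    obtain ⟨F, hF, hconj, -⟩ := isLocalClassFun_of_mem_locCharRing R p hz hf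
    refine ⟨fun c => Quotient.liftOn c.1 F fun x y h => ?_, funext fun x => ?_⟩
    · obtain ⟨t, rfl⟩ := isConj_iff.mp h
      exact (hconj t x).symm
    · rw [hΩ]
      split_ifs with h
      · exact hF x
      · rw [carrier_subset_pSection_iff] at h
        rw [← hfe, Pi.mul_apply, eFun_eq_ite, if_neg h, mul_zero]
  · intro v
    have hx : ∀ h x : G, ConjClasses.mk (h * x * h⁻¹) = ConjClasses.mk x := fun h x =>
      (ConjClasses.mk_eq_mk_iff_isConj.mpr (isConj_iff.mpr ⟨h, rfl⟩)).symm
    have hcomp : Ω (Nat.card G • v) = fun x => algebraMap R K ((Nat.card G : R) *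
        if h : (ConjClasses.mk x).carrier ⊆ pSection p g then v ⟨ConjClasses.mk x, h⟩ else 0) := by
      funext x
      rw [hΩ]
      split_ifs <;> simp
    rw [Nat.cast_smul_eq_nsmul]
    refine ⟨?_, ?_⟩
    · rw [hcomp]
      exact card_smul_mem_locCharRing R hz _ fun h x => by simp only [hx]
    · funext x
      rw [Pi.mul_apply, eFun_eq_ite, hΩ]
      split_ifs with h1 h2 h2
      · rw [mul_one]
      · exact absurd ((carrier_subset_pSection_iff p g x).mp h1) h2
      · rw [zero_mul]
      · rw [zero_mul]

theorem const_mul_mem_pConstIdeal [IsLocalRing R] {r : R} (hr : r ∈ IsLocalRing.maximalIdeal R)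
    (y : locCharRing 𝒪 K 𝔭 G) :
    (⟨Function.const G (algebraMap R K r), const_mem_locCharRing R r⟩ * y :
      locCharRing 𝒪 K 𝔭 G) ∈ pConstIdeal 𝒪 K 𝔭 G := by
  apply Ideal.mul_mem_right
  obtain ⟨a, s, rfl⟩ := IsLocalization.exists_mk'_eq 𝔭.primeCompl r
  rw [IsLocalization.AtPrime.mk'_mem_maximal_iff R 𝔭] at hr
  have : (⟨Function.const G (algebraMap R K (IsLocalization.mk' R a s)),
      const_mem_locCharRing R _⟩ : locCharRing 𝒪 K 𝔭 G)
      = ⟨Function.const G (algebraMap R K (IsLocalization.mk' R 1 s)),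
          const_mem_locCharRing R _⟩ *
        ⟨Function.const G (algebraMap R K (algebraMap 𝒪 R a)), const_mem_locCharRing R _⟩ := by
    refine Subtype.ext (funext fun _ => ?_)
    change algebraMap R K _ = algebraMap R K _ * algebraMap R K _
    rw [← map_mul, IsLocalization.mk'_eq_mul_mk'_one, mul_comm]
  rw [this]
  exact Ideal.mul_mem_left _ _ (Ideal.subset_span ⟨a, hr, by
    rw [IsScalarTower.algebraMap_apply 𝒪 R K]⟩)

/-- Cutting an element of the ideal defining the block by the idempotent lands in `𝔭R_𝔭(G, C)`. -/
theorem mul_mem_smul_locBlock_of_mem_blockIdeal [IsLocalRing R] {e : locCharRing 𝒪 K 𝔭 G}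
    (hee : e * e = e) {x : locCharRing 𝒪 K 𝔭 G} (hx : x ∈ blockIdeal 𝒪 K 𝔭 G e) :
    (x * e : G → K) ∈ IsLocalRing.maximalIdeal R • locBlock 𝔭 R (e : G → K) := by
  have hmem : ∀ y : locCharRing 𝒪 K 𝔭 G, (y * e : G → K) ∈ locBlock 𝔭 R (e : G → K) := fun y =>
    ⟨mul_mem y.2 e.2, by rw [mul_assoc]; exact congrArg (y.1 * ·) (congrArg Subtype.val hee)⟩
  obtain ⟨y, hy, w, hw, rfl⟩ := Submodule.mem_sup.mp hx
  obtain ⟨t, rfl⟩ := Ideal.mem_span_singleton'.mp hw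
  have h0 : (y + t * (1 - e)) * e = 1 * y * e := by
    rw [add_mul, mul_assoc, sub_mul, hee, one_mul, sub_self, mul_zero, add_zero, one_mul]
  change (((y + t * (1 - e)) * e : locCharRing 𝒪 K 𝔭 G) : G → K) ∈ _
  rw [h0]
  clear h0 hx
  generalize (1 : locCharRing 𝒪 K 𝔭 G) = b
  induction hy using Submodule.span_induction generalizing b with
  | mem y hy =>
    obtain ⟨a, ha, h⟩ := hy
    have : ((b * y * e : locCharRing 𝒪 K 𝔭 G) : G → K)
        = algebraMap 𝒪 R a • ((b : G → K) * e) := by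
      funext x
      change b.1 x * y.1 x * e.1 x = algebraMap 𝒪 R a • (b.1 x * e.1 x)
      rw [h, Function.const_apply, Algebra.smul_def, ← IsScalarTower.algebraMap_apply]
      ring
    rw [this]
    exact Submodule.smul_mem_smul ((IsLocalization.AtPrime.to_map_mem_maximal_iff R 𝔭 a).mpr ha)
      (hmem b)
  | zero => simp
  | add y w _ _ hy hw =>
    rw [mul_add, add_mul]
    exact add_mem (hy b) (hw b)
  | smul c y _ hy =>
    rw [smul_eq_mul, ← mul_assoc]
    exact hy (b * c)

end Block
section BlockAlgebra

variable {𝒪 : Type*} [CommRing 𝒪] [IsDomain 𝒪] {K : Type u} [Field K] [Algebra 𝒪 K]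
  [IsFractionRing 𝒪 K] {𝔭 : Ideal 𝒪} {G : Type u} [Group G]
  (R : Type*) [CommRing R] [Algebra 𝒪 R] [Algebra R K] [IsScalarTower 𝒪 R K]

/-- Evaluation at `g` modulo `𝔭`, as a morphism from the block to the residue field. -/
theorem exists_blockAlg_evaluation [𝔭.IsPrime] [IsLocalization.AtPrime R 𝔭] [IsDomain R]
    [IsLocalRing R] [IsFractionRing R K] {e : locCharRing 𝒪 K 𝔭 G} {g : G}
    (he : (e : G → K) g = 1)
    (hval : ∀ f ∈ locCharRing 𝒪 K 𝔭 G, ∃ r : R, algebraMap R K r = f g) :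
    ∃ ev : blockAlg 𝒪 K 𝔭 G e →+* IsLocalRing.ResidueField R,
      ∀ (f : locCharRing 𝒪 K 𝔭 G) (r : R), algebraMap R K r = (f : G → K) g →
        ev (Ideal.Quotient.mk _ f) = IsLocalRing.residue R r := by
  have hinj : Function.Injective (algebraMap R K) := IsFractionRing.injective R K
  choose v hv using fun f : locCharRing 𝒪 K 𝔭 G => hval f.1 f.2
  let E : locCharRing 𝒪 K 𝔭 G →+* R :=
    { toFun := v
      map_one' := hinj (by rw [hv, map_one]; rfl)
      map_mul' := fun a b => hinj (by rw [hv, map_mul, hv, hv]; rfl)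
      map_zero' := hinj (by rw [hv, map_zero]; rfl)
      map_add' := fun a b => hinj (by rw [hv, map_add, hv, hv]; rfl) }
  have hE : ∀ (f : locCharRing 𝒪 K 𝔭 G) (r : R), algebraMap R K r = (f : G → K) g → E f = r :=
    fun f r h => hinj ((hv f).trans h.symm)
  have hker : blockIdeal 𝒪 K 𝔭 G e ≤ RingHom.ker ((IsLocalRing.residue R).comp E) := by
    refine sup_le (Ideal.span_le.mpr ?_) (Ideal.span_le.mpr ?_)
    · rintro f ⟨a, ha, h⟩
      rw [SetLike.mem_coe, RingHom.mem_ker, RingHom.comp_apply, hE f (algebraMap 𝒪 R a) (by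
        rw [h, Function.const_apply, ← IsScalarTower.algebraMap_apply]),
        IsLocalRing.residue_eq_zero_iff]
      exact (IsLocalization.AtPrime.to_map_mem_maximal_iff R 𝔭 a).mpr ha
    · rintro f rfl
      rw [SetLike.mem_coe, RingHom.mem_ker, RingHom.comp_apply, hE _ 0 (by
        change _ = 1 - e.1 g
        rw [he, sub_self, map_zero]), map_zero]
  refine ⟨Ideal.Quotient.lift _ ((IsLocalRing.residue R).comp E)
    fun a ha => RingHom.mem_ker.mp (hker ha), fun f r h => ?_⟩
  rw [Ideal.Quotient.lift_mk, RingHom.comp_apply, hE f r h]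

/-- In a discrete valuation ring, high powers of elements of the maximal ideal are divisible by any
given nonzero element. -/
theorem exists_pow_eq_mul_of_mem_maximalIdeal {R : Type*} [CommRing R] [IsDomain R]
    [IsDiscreteValuationRing R] {a : R} (ha : a ≠ 0) :
    ∃ k : ℕ, ∀ r ∈ IsLocalRing.maximalIdeal R, ∃ t, r ^ k = a * t := by
  obtain ⟨ϖ, hϖ⟩ := IsDiscreteValuationRing.exists_irreducible R
  have hs : Ideal.span ({a} : Set R) ≠ ⊥ := fun h => ha (Ideal.span_singleton_eq_bot.mp h)
  obtain ⟨k, hk⟩ := IsDiscreteValuationRing.ideal_eq_span_pow_irreducible hs hϖ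
  refine ⟨k, fun r hr => ?_⟩
  rw [hϖ.maximalIdeal_eq, Ideal.mem_span_singleton] at hr
  have h : ϖ ^ k ∈ Ideal.span ({a} : Set R) := hk ▸ Ideal.mem_span_singleton_self _
  exact (Ideal.mem_span_singleton.mp h).trans (pow_dvd_pow_of_dvd hr k)

/-- The kernel of evaluation at `g` on the block of `g` is nil. -/
theorem isNilpotent_mk_blockIdeal [𝔭.IsPrime] [IsLocalization.AtPrime R 𝔭] (p : ℕ) [Fact p.Prime]
    [IsDomain R] [IsDiscreteValuationRing R] [CharZero K]
    [IsFractionRing R K] [CharP (IsLocalRing.ResidueField R) p] [Finite G] {z : K}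
    (hz : IsPrimitiveRoot z (Nat.card G)) (g : G) (hg : IsPRegular p g)
    (he : eFun p K g ∈ locCharRing 𝒪 K 𝔭 G) (f : locCharRing 𝒪 K 𝔭 G)
    (hf : ∀ r : R, algebraMap R K r = (f : G → K) g → IsLocalRing.residue R r = 0) :
    IsNilpotent (Ideal.Quotient.mk (blockIdeal 𝒪 K 𝔭 G ⟨eFun p K g, he⟩) f) := by
  have hinj : Function.Injective (algebraMap R K) := IsFractionRing.injective R K
  have : CharZero R := ⟨fun a b h => by
    have h' := congrArg (algebraMap R K) h
    rwa [map_natCast, map_natCast, Nat.cast_inj] at h'⟩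
  obtain ⟨ϖ, hϖ⟩ := IsDiscreteValuationRing.exists_irreducible R
  have hϖm : ϖ ∈ IsLocalRing.maximalIdeal R := hϖ.not_isUnit
  have hne : (Nat.card G : R) * ϖ ≠ 0 := mul_ne_zero (Nat.cast_ne_zero.mpr Nat.card_pos.ne') hϖ.ne_zero
  obtain ⟨k, hk⟩ := exists_pow_eq_mul_of_mem_maximalIdeal hne
  obtain ⟨F, hF, hconj, hres⟩ :=
    isLocalClassFun_of_mem_locCharRing R p hz (mul_mem f.2 he)
  have hFm : ∀ x, F x ∈ IsLocalRing.maximalIdeal R := by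
    intro x
    by_cases hx : x ∈ pSection p g
    · obtain ⟨t, ht⟩ := isConj_iff.mp (show IsConj g (pPrimePart p x) from hx)
      rw [← IsLocalRing.residue_eq_zero_iff, hres, ← ht, hconj]
      apply hf
      have hgg : g ∈ pSection p g := by
        change IsConj g (pPrimePart p g)
        rw [pPrimePart_eq_self hg]
      rw [hF, Pi.mul_apply, eFun_eq_ite, if_pos hgg, mul_one]
    · have : F x = 0 := hinj (by
        rw [hF, Pi.mul_apply, eFun_eq_ite, if_neg hx, mul_zero, map_zero])
      rw [this]
      exact zero_mem _
  choose H hH using fun x => hk (F x) (hFm x)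
  have hHconj : ∀ h x, H (h * x * h⁻¹) = H x := fun h x =>
    mul_left_cancel₀ hne (by rw [← hH, ← hH, hconj])
  have hmk : Ideal.Quotient.mk (blockIdeal 𝒪 K 𝔭 G ⟨eFun p K g, he⟩) f
      = Ideal.Quotient.mk _ (f * ⟨eFun p K g, he⟩) := by
    refine Ideal.Quotient.eq.mpr (Ideal.mem_sup_right (Ideal.mem_span_singleton'.mpr ⟨f, ?_⟩))
    rw [mul_sub, mul_one]
  refine ⟨k, ?_⟩
  rw [hmk, ← map_pow, Ideal.Quotient.eq_zero_iff_mem]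
  apply Ideal.mem_sup_left
  have : (f * ⟨eFun p K g, he⟩) ^ k
      = (⟨Function.const G (algebraMap R K ϖ), const_mem_locCharRing R ϖ⟩ *
        ⟨_, card_smul_mem_locCharRing R hz H hHconj⟩ : locCharRing 𝒪 K 𝔭 G) := by
    refine Subtype.ext (funext fun x => ?_)
    change ((f : G → K) * eFun p K g) x ^ k
      = algebraMap R K ϖ * algebraMap R K ((Nat.card G : R) * H x)
    rw [← hF, ← map_pow, hH, ← map_mul]
    congr 1
    ring
  rw [this]
  exact const_mul_mem_pConstIdeal R hϖm _

/-- The block of `kR(G)` has the same dimension as the rank of the block of `𝒪_𝔭R(G)`. -/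
theorem finite_and_finrank_blockAlg [𝔭.IsMaximal] [IsLocalization.AtPrime R 𝔭]
    [IsDomain R] [IsLocalRing R] {e : locCharRing 𝒪 K 𝔭 G} (hee : e * e = e)
    [Module.Finite R (locBlock 𝔭 R (e : G → K))] [Module.Free R (locBlock 𝔭 R (e : G → K))] :
    letI := Ideal.Quotient.field 𝔭
    letI := (blockScalars 𝒪 K 𝔭 G e).toAlgebra
    Module.Finite (𝒪 ⧸ 𝔭) (blockAlg 𝒪 K 𝔭 G e) ∧
    Module.finrank (𝒪 ⧸ 𝔭) (blockAlg 𝒪 K 𝔭 G e) =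
      Module.finrank R (locBlock 𝔭 R (e : G → K)) := by
  let := Ideal.Quotient.field 𝔭
  let := (blockScalars 𝒪 K 𝔭 G e).toAlgebra
  let b := Module.Free.chooseBasis R (locBlock 𝔭 R (e : G → K))
  let v : Module.Free.ChooseBasisIndex R (locBlock 𝔭 R (e : G → K)) → blockAlg 𝒪 K 𝔭 G e :=
    fun i => Ideal.Quotient.mk _ ⟨b i, (b i).2.1⟩
  have hsmul : ∀ (a : 𝒪) (y : locCharRing 𝒪 K 𝔭 G),
      (Ideal.Quotient.mk 𝔭 a) • (Ideal.Quotient.mk (blockIdeal 𝒪 K 𝔭 G e) y)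
        = Ideal.Quotient.mk (blockIdeal 𝒪 K 𝔭 G e) (constRingHom 𝒪 K 𝔭 G a * y) :=
    fun _ _ => rfl
  have hconst : ∀ (a : 𝒪) (y : locCharRing 𝒪 K 𝔭 G),
      ((constRingHom 𝒪 K 𝔭 G a * y : locCharRing 𝒪 K 𝔭 G) : G → K)
        = algebraMap 𝒪 R a • (y : G → K) := by
    intro a y
    funext x
    rw [Pi.smul_apply, Algebra.smul_def, ← IsScalarTower.algebraMap_apply]
    rfl
  have hli : LinearIndependent (𝒪 ⧸ 𝔭) v := by
    rw [Fintype.linearIndependent_iff]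
    intro c hc
    choose a ha using fun i => Ideal.Quotient.mk_surjective (c i)
    have h1 : (∑ i, constRingHom 𝒪 K 𝔭 G (a i) * ⟨b i, (b i).2.1⟩ : locCharRing 𝒪 K 𝔭 G)
        ∈ blockIdeal 𝒪 K 𝔭 G e := by
      rw [← Ideal.Quotient.eq_zero_iff_mem, map_sum, ← hc]
      exact Finset.sum_congr rfl fun i _ => by rw [← ha i, ← hsmul]
    have h2 := mul_mem_smul_locBlock_of_mem_blockIdeal R hee h1
    have h3 : ((∑ i, constRingHom 𝒪 K 𝔭 G (a i) * ⟨b i, (b i).2.1⟩ : locCharRing 𝒪 K 𝔭 G) :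
        G → K) * e = ((∑ i, algebraMap 𝒪 R (a i) • b i : locBlock 𝔭 R (e : G → K)) : G → K) := by
      rw [AddSubmonoidClass.coe_finsetSum, AddSubmonoidClass.coe_finsetSum, Finset.sum_mul]
      refine Finset.sum_congr rfl fun i _ => ?_
      rw [hconst, smul_mul_assoc, (b i).2.2]
      rfl
    rw [h3, ← Submodule.mem_smul_top_iff] at h2
    have h4 : ∀ y ∈ IsLocalRing.maximalIdeal R • (⊤ : Submodule R (locBlock 𝔭 R (e : G → K))),
        ∀ i, b.repr y i ∈ IsLocalRing.maximalIdeal R := by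
      intro y hy i
      induction hy using Submodule.smul_induction_on' with
      | smul r hr n _ =>
        rw [map_smul, Finsupp.smul_apply, smul_eq_mul]
        exact Ideal.mul_mem_right _ _ hr
      | add x _ y _ hx hy =>
        rw [map_add, Finsupp.add_apply]
        exact add_mem hx hy
    intro i
    have h5 := h4 _ h2 i
    rw [b.repr_sum_self] at h5
    rw [← ha, Ideal.Quotient.eq_zero_iff_mem]
    exact (IsLocalization.AtPrime.to_map_mem_maximal_iff R 𝔭 _).mp h5
  have hspan : ⊤ ≤ Submodule.span (𝒪 ⧸ 𝔭) (Set.range v) := by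
    rintro q -
    obtain ⟨f, rfl⟩ := Ideal.Quotient.mk_surjective q
    have hfe : (f * e : G → K) ∈ locBlock 𝔭 R (e : G → K) :=
      ⟨mul_mem f.2 e.2, by rw [mul_assoc]; exact congrArg (f.1 * ·) (congrArg Subtype.val hee)⟩
    have hmk : Ideal.Quotient.mk (blockIdeal 𝒪 K 𝔭 G e) f = Ideal.Quotient.mk _ (f * e) := by
      refine Ideal.Quotient.eq.mpr (Ideal.mem_sup_right (Ideal.mem_span_singleton'.mpr ⟨f, ?_⟩))
      rw [mul_sub, mul_one]
    have hres : ∀ r : R, ∃ a : 𝒪, r - algebraMap 𝒪 R a ∈ IsLocalRing.maximalIdeal R := by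
      intro r
      obtain ⟨q, hq⟩ := (IsLocalization.AtPrime.equivQuotMaximalIdeal 𝔭 R).surjective
        (Ideal.Quotient.mk _ r)
      obtain ⟨a, rfl⟩ := Ideal.Quotient.mk_surjective q
      rw [IsLocalization.AtPrime.equivQuotMaximalIdeal_apply_mk] at hq
      exact ⟨a, Ideal.Quotient.eq.mp hq.symm⟩
    obtain ⟨c, hc⟩ : ∃ c : _ → R, ((∑ i, c i • b i : locBlock 𝔭 R (e : G → K)) : G → K)
        = (f : G → K) * e := ⟨_, congrArg Subtype.val (b.sum_repr ⟨_, hfe⟩)⟩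
    choose a ha using fun i => hres (c i)
    have hsum : Ideal.Quotient.mk (blockIdeal 𝒪 K 𝔭 G e) f
        = ∑ i, Ideal.Quotient.mk 𝔭 (a i) • v i := by
      rw [hmk]
      simp only [v, hsmul]
      rw [← map_sum, Ideal.Quotient.eq]
      apply Ideal.mem_sup_left
      have : f * e - ∑ i, constRingHom 𝒪 K 𝔭 G (a i) * ⟨b i, (b i).2.1⟩
          = ∑ i, (⟨Function.const G (algebraMap R K (c i - algebraMap 𝒪 R (a i))),
              const_mem_locCharRing R _⟩ * ⟨b i, (b i).2.1⟩ : locCharRing 𝒪 K 𝔭 G) := by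
        refine Subtype.ext ?_
        rw [AddSubgroupClass.coe_sub, AddSubmonoidClass.coe_finsetSum,
          AddSubmonoidClass.coe_finsetSum]
        change (f : G → K) * (e : G → K) - _ = _
        rw [← hc, AddSubmonoidClass.coe_finsetSum, ← Finset.sum_sub_distrib]
        refine Finset.sum_congr rfl fun i _ => ?_
        rw [hconst, Submodule.coe_smul, ← sub_smul]
        exact funext fun x => Algebra.smul_def _ _
      rw [this]
      exact sum_mem fun i _ => const_mul_mem_pConstIdeal R (ha i) _
    rw [hsum]
    exact sum_mem fun i _ => Submodule.smul_mem _ _ (Submodule.subset_span ⟨i, rfl⟩)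
  let B := Module.Basis.mk hli hspan
  exact ⟨Module.Finite.of_basis B, by
    rw [Module.finrank_eq_card_basis B, Module.finrank_eq_card_basis b]⟩

end BlockAlgebra

variable {𝒪 : Type*} [CommRing 𝒪] [IsDomain 𝒪] [IsDedekindDomain 𝒪] [CharZero 𝒪]
variable {K : Type u} [Field K] [Algebra 𝒪 K] [IsFractionRing 𝒪 K]
variable {𝔭 : Ideal 𝒪} [𝔭.IsMaximal]

set_option maxHeartbeats 2000000 in
set_option synthInstance.maxHeartbeats 1000000 in
/-- Let `C` be a `p`-regular class of `G`, with representative `g`.  Then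
`dim_k kR_𝔭(G,C) = rank_{𝒪_𝔭} R_𝔭(G,C) = |S_{p'}(C)/∼|`; moreover `kR_𝔭(G,C)` is a local
commutative `k`-algebra with residue field `k` (so `kR_𝔭(G,C)/Rad ≅ D̄_C`, the one-dimensional
simple module attached to `C`), and as a module over `kR(G)` (equivalently over itself) the
block has a composition series of length `|S_{p'}(C)/∼|`, all of whose factors are the unique
simple module `D̄_C`. -/
theorem block_dimension_and_locality
    (p : ℕ) [Fact p.Prime] (hp : (p : 𝒪) ∈ 𝔭)
    {G : Type u} [Group G] [Finite G]
    (ζ : K) (hζ : IsPrimitiveRoot ζ (Nat.card G))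
    (g : G) (hg : IsPRegular p g) (he : eFun p K g ∈ locCharRing 𝒪 K 𝔭 G) :
    kDim (𝒪 ⧸ 𝔭) (blockScalars 𝒪 K 𝔭 G ⟨eFun p K g, he⟩) = numClassesIn (pSection p g) ∧
    blockLocRank p 𝒪 K 𝔭 G g = numClassesIn (pSection p g) ∧
    IsLocalRing (blockAlg 𝒪 K 𝔭 G ⟨eFun p K g, he⟩) ∧
    Function.Bijective
      ((Ideal.Quotient.mk (jacRad (blockAlg 𝒪 K 𝔭 G ⟨eFun p K g, he⟩))).comp
        (blockScalars 𝒪 K 𝔭 G ⟨eFun p K g, he⟩)) ∧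
    ∃ s : CompositionSeries (Submodule (blockAlg 𝒪 K 𝔭 G ⟨eFun p K g, he⟩)
        (blockAlg 𝒪 K 𝔭 G ⟨eFun p K g, he⟩)),
      s.head = ⊥ ∧ s.last = ⊤ ∧ s.length = numClassesIn (pSection p g) := by
  have hp0 : p ≠ 0 := (Fact.out : p.Prime).ne_zero
  have h𝔭 : 𝔭 ≠ ⊥ := by
    rintro rfl
    exact hp0 (by exact_mod_cast (Ideal.mem_bot.mp hp))
  let : Algebra (Localization.AtPrime 𝔭) K := (locToK 𝒪 K 𝔭).toAlgebra
  have htower : IsScalarTower 𝒪 (Localization.AtPrime 𝔭) K :=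
    IsScalarTower.of_algebraMap_eq fun a => (IsLocalization.lift_eq _ a).symm
  have hfrac : IsFractionRing (Localization.AtPrime 𝔭) K :=
    IsFractionRing.isFractionRing_of_isDomain_of_isLocalization 𝔭.primeCompl _ K
  have hdvr : IsDiscreteValuationRing (Localization.AtPrime 𝔭) :=
    IsLocalization.AtPrime.isDiscreteValuationRing_of_dedekind_domain 𝒪 h𝔭 _
  have hK : CharZero K := ⟨fun a b h => by
    rw [← map_natCast (algebraMap 𝒪 K), ← map_natCast (algebraMap 𝒪 K)] at h
    exact Nat.cast_injective (IsFractionRing.injective 𝒪 K h)⟩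
  have hchar : CharP (IsLocalRing.ResidueField (Localization.AtPrime 𝔭)) p := by
    refine (CharP.charP_iff_prime_eq_zero Fact.out).mpr ?_
    rw [← map_natCast (IsLocalRing.residue (Localization.AtPrime 𝔭)),
      IsLocalRing.residue_eq_zero_iff, ← map_natCast (algebraMap 𝒪 (Localization.AtPrime 𝔭))]
    exact (IsLocalization.AtPrime.to_map_mem_maximal_iff (Localization.AtPrime 𝔭) 𝔭 (p : 𝒪)).mpr hp
  have hee : (⟨eFun p K g, he⟩ : locCharRing 𝒪 K 𝔭 G) * ⟨eFun p K g, he⟩ = ⟨eFun p K g, he⟩ :=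
    Subtype.ext (eFun_mul_self p g)
  obtain ⟨hfin, hrank⟩ :=
    finite_and_finrank_locBlock (𝔭 := 𝔭) (Localization.AtPrime 𝔭) p hζ g
  have hfree : Module.Free (Localization.AtPrime 𝔭)
      (locBlock 𝔭 (Localization.AtPrime 𝔭) (eFun p K g)) := inferInstance
  obtain ⟨ev, hev⟩ := exists_blockAlg_evaluation (Localization.AtPrime 𝔭)
    (e := ⟨eFun p K g, he⟩) (g := g)
    (by
      change eFun p K g g = 1
      rw [eFun, pPrimePart_eq_self hg, if_pos (IsConj.refl g)])
    (fun f hf => by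
      obtain ⟨F, hF, -⟩ :=
        isLocalClassFun_of_mem_locCharRing (Localization.AtPrime 𝔭) p hζ hf
      exact ⟨F g, hF g⟩)
  have hnil : ∀ b, ev b = 0 → IsNilpotent b := by
    intro b hb
    obtain ⟨f, rfl⟩ := Ideal.Quotient.mk_surjective b
    exact isNilpotent_mk_blockIdeal (Localization.AtPrime 𝔭) p hζ g hg he f
      fun r hr => (hev f r hr).symm.trans hb
  let := Ideal.Quotient.field 𝔭
  let := (blockScalars 𝒪 K 𝔭 G ⟨eFun p K g, he⟩).toAlgebra
  have hsurj : Function.Surjective (ev.comp (blockScalars 𝒪 K 𝔭 G ⟨eFun p K g, he⟩)) := by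
    intro l
    obtain ⟨q, rfl⟩ := (IsLocalization.AtPrime.equivQuotMaximalIdeal 𝔭
      (Localization.AtPrime 𝔭)).surjective l
    obtain ⟨a, rfl⟩ := Ideal.Quotient.mk_surjective q
    refine ⟨Ideal.Quotient.mk 𝔭 a, ?_⟩
    rw [IsLocalization.AtPrime.equivQuotMaximalIdeal_apply_mk]
    exact hev (constRingHom 𝒪 K 𝔭 G a) (algebraMap 𝒪 _ a)
      (IsScalarTower.algebraMap_apply 𝒪 (Localization.AtPrime 𝔭) K a).symm
  obtain ⟨hBfin, hBrank⟩ := finite_and_finrank_blockAlg (𝔭 := 𝔭) (Localization.AtPrime 𝔭) hee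
  have hdim : Module.finrank (𝒪 ⧸ 𝔭) (blockAlg 𝒪 K 𝔭 G ⟨eFun p K g, he⟩)
      = numClassesIn (pSection p g) := hBrank.trans hrank
  refine ⟨hdim, ?_, isLocalRing_of_nil_ker ev (Function.Surjective.of_comp hsurj) hnil,
    bijective_mk_jacRad_comp _ ev hsurj hnil, ?_⟩
  · have hspan : Submodule.span (Localization.AtPrime 𝔭)
        {f : G → K | f ∈ locCharRing 𝒪 K 𝔭 G ∧ f * eFun p K g = f}
        = locBlock 𝔭 (Localization.AtPrime 𝔭) (eFun p K g) :=
      Submodule.span_eq (locBlock 𝔭 (Localization.AtPrime 𝔭) (eFun p K g))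
    rw [← hrank, ← hspan]
    rfl
  · rw [← hdim]
    exact exists_compositionSeries_length_eq_finrank ev hsurj hnil
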